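/- Let U and V be independent standard Gaussian random variables, let m, n be nonnegative integers, let r be a positive integer, and let 0 < γ < 1. Then E[U^{2m} V^{2n} (γU² − (1−γ)V²)^{2r}] = 2^{m+n+2r} · (1/2)_m · (1/2)_{n+2r} · ∑_{i=0}^{2r} [ (−2r)_i · (−m−n−2r)_i / ( (1/2 − n − 2r)_i · i! ) ] · γ^i, where all rising factorials are of real numbers. -/

import Mathlib

open MeasureTheory ProbabilityTheory
open scoped NNReal

/-- The rising factorial `(α)_k = α (α+1) ⋯ (α+k-1)`, with `(α)_0 = 1`. -/
def risingFactorial (α : ℝ) (k : ℕ) : ℝ := ∏ j ∈ Finset.range k, (α + j)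

lemma risingFactorial_zero (α : ℝ) : risingFactorial α 0 = 1 := by
  simp [risingFactorial]

lemma risingFactorial_succ (α : ℝ) (k : ℕ) :
    risingFactorial α (k + 1) = risingFactorial α k * (α + k) :=
  Finset.prod_range_succ _ _

lemma risingFactorial_succ_left (α : ℝ) (k : ℕ) :
    risingFactorial α (k + 1) = α * risingFactorial (α + 1) k := by
  simp only [risingFactorial, Finset.prod_range_succ', Nat.cast_zero, add_zero]
  rw [mul_comm]
  congr 1
  refine Finset.prod_congr rfl fun j _ ↦ ?_
  push_cast
  ring

lemma risingFactorial_pos {α : ℝ} (hα : 0 < α) (k : ℕ) : 0 < risingFactorial α k :=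
  Finset.prod_pos fun _ _ ↦ by positivity

lemma risingFactorial_neg_natCast (x k : ℕ) :
    risingFactorial (-(x : ℝ)) k = (-1) ^ k * x.descFactorial k := by
  induction k with
  | zero => simp [risingFactorial_zero]
  | succ k ih =>
    rw [risingFactorial_succ, ih, Nat.descFactorial_succ]
    rcases le_or_gt k x with h | h
    · push_cast [h]
      ring
    · simp [Nat.descFactorial_of_lt h]

/-- Reversing the order of the last `i` factors of `(α)_{j+i}`. -/
lemma risingFactorial_add_eq_reflect (α : ℝ) (j i : ℕ) :
    risingFactorial α (j + i) =
      (-1) ^ i * risingFactorial (1 - α - j - i) i * risingFactorial α j := by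
  induction i with
  | zero => simp [risingFactorial_zero]
  | succ i ih =>
    rw [← add_assoc, risingFactorial_succ, ih, risingFactorial_succ_left]
    have h : 1 - α - j - ((i + 1 : ℕ) : ℝ) + 1 = 1 - α - j - i := by push_cast; ring
    rw [h]
    push_cast
    ring

lemma Gamma_natCast_add_half_eq_risingFactorial (k : ℕ) :
    Real.Gamma (k + 1 / 2) = risingFactorial (1 / 2) k * √Real.pi := by
  induction k with
  | zero => simpa [risingFactorial_zero] using Real.Gamma_one_half_eq
  | succ k ih =>
    have h : ((k + 1 : ℕ) : ℝ) + 1 / 2 = (k + 1 / 2) + 1 := by push_cast; ring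
    rw [h, Real.Gamma_add_one (by positivity), ih, risingFactorial_succ]
    ring

/-- The even moments of the standard Gaussian distribution. -/
lemma integral_pow_two_mul_gaussianReal (k : ℕ) :
    ∫ x, x ^ (2 * k) ∂gaussianReal 0 1 = 2 ^ k * risingFactorial (1 / 2) k := by
  have hIoi : ∫ x in Set.Ioi (0 : ℝ), x ^ (2 * k) * Real.exp (-x ^ 2 / 2) =
      (1 / 2) * (2 ^ k * √2 * (risingFactorial (1 / 2) k * √Real.pi)) := by
    have h := integral_rpow_mul_exp_neg_mul_rpow (p := 2) (q := 2 * k) (b := 1 / 2)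
      (by norm_num) (by linarith [(Nat.cast_nonneg k : (0 : ℝ) ≤ k)]) (by norm_num)
    have hG : (2 * (k : ℝ) + 1) / 2 = k + 1 / 2 := by ring
    have hpow : (1 / 2 : ℝ) ^ (-(2 * (k : ℝ) + 1) / 2) = 2 ^ k * √2 := by
      rw [neg_div, hG, one_div, Real.inv_rpow (by norm_num), Real.rpow_neg (by norm_num), inv_inv,
        Real.rpow_add (by norm_num), Real.rpow_natCast, Real.sqrt_eq_rpow, one_div]
    rw [hpow, hG, Gamma_natCast_add_half_eq_risingFactorial] at h
    rw [mul_left_comm, ← mul_assoc, ← h]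
    refine setIntegral_congr_fun measurableSet_Ioi fun x _ ↦ ?_
    have h1 : x ^ (2 * (k : ℝ)) = x ^ (2 * k) := by
      rw [← Real.rpow_natCast]; push_cast; rfl
    have h2 : -(1 / 2 : ℝ) * x ^ (2 : ℝ) = -x ^ 2 / 2 := by
      rw [Real.rpow_two]; ring
    simp only [h1, h2]
  have habs := integral_comp_abs (f := fun x : ℝ ↦ x ^ (2 * k) * Real.exp (-x ^ 2 / 2))
  rw [hIoi] at habs
  simp only [pow_mul, sq_abs] at habs
  rw [integral_gaussianReal_eq_integral_smul one_ne_zero]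
  have hpdf (x : ℝ) : gaussianPDFReal 0 1 x • x ^ (2 * k) =
      (√2 * √Real.pi)⁻¹ * ((x ^ 2) ^ k * Real.exp (-x ^ 2 / 2)) := by
    simp only [gaussianPDFReal, smul_eq_mul, NNReal.coe_one, mul_one, sub_zero, pow_mul]
    rw [Real.sqrt_mul (by norm_num)]
    ring
  simp only [hpdf]
  rw [integral_const_mul, habs]
  have hpi : √Real.pi ≠ 0 := (Real.sqrt_pos.2 Real.pi_pos).ne'
  field_simp

lemma integrable_pow_gaussianReal (μ : ℝ) (v : ℝ≥0) (k : ℕ) :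
    Integrable (fun x ↦ x ^ k) (gaussianReal μ v) := by
  have h := (memLp_id_gaussianReal (μ := μ) (v := v) k).integrable_norm_pow'
  exact (integrable_norm_iff (by fun_prop)).1 (by simpa using h)

/-- The normalized moment `E[U^{2m} V^{2n} ((1-γ)V² - γU²)^N]`, up to the factor
`2^{m+n+N} (1/2)_m`. -/
noncomputable def gaussianMomentSum (γ : ℝ) (N m n : ℕ) : ℝ :=
  ∑ p ∈ Finset.HasAntidiagonal.antidiagonal N, (N.choose p.1 : ℝ) *
    ((-γ) ^ p.1 * (m + n + N).descFactorial p.1 * risingFactorial (1 / 2) (n + p.2))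

lemma risingFactorial_mul_gaussianMomentSum_succ (γ : ℝ) (N m n : ℕ) :
    risingFactorial (1 / 2) m * gaussianMomentSum γ (N + 1) m n =
      (1 - γ) * (risingFactorial (1 / 2) m * gaussianMomentSum γ N m (n + 1)) -
        γ * (risingFactorial (1 / 2) (m + 1) * gaussianMomentSum γ N (m + 1) n) := by
  have hK₁ : m + (n + 1) + N = m + n + (N + 1) := by ring
  have hK₂ : m + 1 + n + N = m + n + (N + 1) := by ring
  simp only [gaussianMomentSum, hK₁, hK₂]
  rw [Finset.sum_antidiagonal_choose_succ_mul (fun i j ↦ (-γ) ^ i *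
    ((m + n + (N + 1)).descFactorial i : ℝ) * risingFactorial (1 / 2) (n + j))]
  simp only [Finset.mul_sum, ← Finset.sum_add_distrib, ← Finset.sum_sub_distrib]
  refine Finset.sum_congr rfl fun p hp ↦ ?_
  obtain ⟨i, j⟩ := p
  obtain rfl : i + j = N := by simpa using hp
  have hsymm : (i + j).choose j = (i + j).choose i := (Nat.choose_symm_add).symm
  have hsub : m + n + i + j + 1 - i = m + n + j + 1 := by omega
  have hn : n + 1 + j = n + j + 1 := by ring
  simp only [hsymm, Nat.descFactorial_succ, hsub, hn, ← add_assoc, risingFactorial_succ]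
  push_cast
  ring

section Moments

variable {Ω : Type*} [MeasurableSpace Ω] {P : Measure Ω} {U V : Ω → ℝ}

lemma integrable_and_integral_pow_mul_pow_mul_pow
    (hU : Measure.map U P = gaussianReal 0 1) (hV : Measure.map V P = gaussianReal 0 1)
    (hindep : IndepFun U V P) (γ : ℝ) (N m n : ℕ) :
    Integrable (fun ω ↦ U ω ^ (2 * m) * V ω ^ (2 * n) *
        ((1 - γ) * V ω ^ 2 - γ * U ω ^ 2) ^ N) P ∧
      ∫ ω, U ω ^ (2 * m) * V ω ^ (2 * n) * ((1 - γ) * V ω ^ 2 - γ * U ω ^ 2) ^ N ∂P =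
        2 ^ (m + n + N) * (risingFactorial (1 / 2) m * gaussianMomentSum γ N m n) := by
  induction N generalizing m n with
  | zero =>
    have hUm : AEMeasurable U P := aemeasurable_of_map_neZero (by rw [hU]; infer_instance)
    have hVm : AEMeasurable V P := aemeasurable_of_map_neZero (by rw [hV]; infer_instance)
    have key {X : Ω → ℝ} (hXm : AEMeasurable X P) (hX : Measure.map X P = gaussianReal 0 1)
        (k : ℕ) : Integrable (fun ω ↦ X ω ^ (2 * k)) P ∧
          ∫ ω, X ω ^ (2 * k) ∂P = 2 ^ k * risingFactorial (1 / 2) k := by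
      constructor
      · refine Integrable.comp_aemeasurable (g := fun x : ℝ ↦ x ^ (2 * k)) ?_ hXm
        rw [hX]
        exact integrable_pow_gaussianReal 0 1 _
      · rw [← integral_pow_two_mul_gaussianReal, ← hX,
          integral_map hXm (by fun_prop)]
    obtain ⟨hUi, hUk⟩ := key hUm hU m
    obtain ⟨hVi, hVk⟩ := key hVm hV n
    have hind : IndepFun (fun ω ↦ U ω ^ (2 * m)) (fun ω ↦ V ω ^ (2 * n)) P :=
      hindep.comp (φ := fun x ↦ x ^ (2 * m)) (ψ := fun x ↦ x ^ (2 * n))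
        (by fun_prop) (by fun_prop)
    simp only [pow_zero, mul_one]
    refine ⟨hind.integrable_mul hUi hVi, ?_⟩
    rw [hind.integral_fun_mul_eq_mul_integral hUi.1 hVi.1, hUk, hVk]
    simp [gaussianMomentSum]
    ring
  | succ N ih =>
    obtain ⟨hi₁, he₁⟩ := ih m (n + 1)
    obtain ⟨hi₂, he₂⟩ := ih (m + 1) n
    have hsplit : (fun ω ↦ U ω ^ (2 * m) * V ω ^ (2 * n) *
          ((1 - γ) * V ω ^ 2 - γ * U ω ^ 2) ^ (N + 1)) = fun ω ↦
        (1 - γ) * (U ω ^ (2 * m) * V ω ^ (2 * (n + 1)) *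
          ((1 - γ) * V ω ^ 2 - γ * U ω ^ 2) ^ N) -
        γ * (U ω ^ (2 * (m + 1)) * V ω ^ (2 * n) *
          ((1 - γ) * V ω ^ 2 - γ * U ω ^ 2) ^ N) := by
      ext ω
      ring
    rw [hsplit]
    refine ⟨(hi₁.const_mul _).sub (hi₂.const_mul _), ?_⟩
    rw [integral_sub (hi₁.const_mul _) (hi₂.const_mul _), integral_const_mul, integral_const_mul,
      he₁, he₂, risingFactorial_mul_gaussianMomentSum_succ]
    ring

end Moments

lemma gaussianMomentSum_eq_hypergeometric (γ : ℝ) (N m n : ℕ) :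
    gaussianMomentSum γ N m n = risingFactorial (1 / 2) (n + N) *
      ∑ i ∈ Finset.range (N + 1), risingFactorial (-(N : ℝ)) i *
        risingFactorial (-((m : ℝ) + n + N)) i /
          (risingFactorial (1 / 2 - (n : ℝ) - N) i * (i.factorial : ℝ)) * γ ^ i := by
  rw [gaussianMomentSum, Finset.Nat.sum_antidiagonal_eq_sum_range_succ_mk, Finset.mul_sum]
  refine Finset.sum_congr rfl fun i hi ↦ ?_
  obtain ⟨j, rfl⟩ := Nat.exists_eq_add_of_le' (Finset.mem_range_succ_iff.1 hi)
  have hrefl := risingFactorial_add_eq_reflect (1 / 2) (n + j) i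
  have harg : 1 - 1 / 2 - ((n + j : ℕ) : ℝ) - i = 1 / 2 - (n : ℝ) - ((j + i : ℕ) : ℝ) := by
    push_cast; ring
  have hcast : -((m : ℝ) + n + ((j + i : ℕ) : ℝ)) = -((m + n + (j + i) : ℕ) : ℝ) := by
    push_cast; ring
  rw [harg, add_assoc] at hrefl
  have hne : risingFactorial (1 / 2 - (n : ℝ) - ((j + i : ℕ) : ℝ)) i ≠ 0 := by
    intro h0
    rw [h0, mul_zero, zero_mul] at hrefl
    exact (risingFactorial_pos (by norm_num) _).ne' hrefl
  have hfac : (i.factorial : ℝ) ≠ 0 := by positivity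
  rw [hcast, risingFactorial_neg_natCast, risingFactorial_neg_natCast, hrefl,
    Nat.descFactorial_eq_factorial_mul_choose (j + i), Nat.add_sub_cancel, neg_pow γ]
  generalize risingFactorial (1 / 2 - (n : ℝ) - ((j + i : ℕ) : ℝ)) i = d at hne ⊢
  push_cast
  field_simp
  rw [← pow_mul, mul_comm i 2, pow_mul]
  simp

/-- For independent standard Gaussians `U, V`, nonnegative integers `m, n`,
a positive integer `r` and `0 < γ < 1`:
`E[U^{2m} V^{2n} (γU² - (1-γ)V²)^{2r}]
  = 2^{m+n+2r} (1/2)_m (1/2)_{n+2r} F(-2r, -m-n-2r, 1/2-n-2r; γ)`,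
where `F` is the terminating Gaussian hypergeometric series. -/
theorem gaussian_moment_hypergeometric
    {Ω : Type*} [MeasurableSpace Ω] (P : Measure Ω) [IsProbabilityMeasure P]
    (U V : Ω → ℝ)
    (hU : Measure.map U P = gaussianReal 0 1)
    (hV : Measure.map V P = gaussianReal 0 1)
    (hindep : IndepFun U V P)
    (m n r : ℕ) (hr : 0 < r) (γ : ℝ) (h0 : 0 < γ) (h1 : γ < 1) :
    (∫ ω, (U ω) ^ (2 * m) * (V ω) ^ (2 * n) *
        (γ * (U ω) ^ 2 - (1 - γ) * (V ω) ^ 2) ^ (2 * r) ∂P)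
      = 2 ^ (m + n + 2 * r) * risingFactorial (1 / 2) m *
          risingFactorial (1 / 2) (n + 2 * r) *
          ∑ i ∈ Finset.range (2 * r + 1),
            risingFactorial (-(2 * (r : ℝ))) i *
              risingFactorial (-((m : ℝ) + (n : ℝ) + 2 * (r : ℝ))) i /
              (risingFactorial (1 / 2 - (n : ℝ) - 2 * (r : ℝ)) i * (Nat.factorial i : ℝ)) *
              γ ^ i := by
  have hflip (ω : Ω) : (γ * U ω ^ 2 - (1 - γ) * V ω ^ 2) ^ (2 * r) =
      ((1 - γ) * V ω ^ 2 - γ * U ω ^ 2) ^ (2 * r) := by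
    rw [← (even_two_mul r).neg_pow, neg_sub]
  simp only [hflip]
  rw [(integrable_and_integral_pow_mul_pow_mul_pow hU hV hindep γ (2 * r) m n).2,
    gaussianMomentSum_eq_hypergeometric]
  push_cast
  ring
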